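/- Let α_o ∈ [−1,1], α ∈ ℝ, b ∈ ℝ and c ∈ ℝ with α² ≤ c ≤ 1. For each integer k ≥ 1, let M_k be the (k+1)×(k+1) real symmetric matrix with entries M_k(0,0) = 1 − α_o², M_k(0,i) = M_k(i,0) = b for 1 ≤ i ≤ k, and M_k(i,j) = (1−c)·δ_{ij} + (c − α²) for 1 ≤ i,j ≤ k. Then M_k is positive semidefinite for every k ≥ 1 if and only if b² ≤ (c − α²)·(1 − α_o²). -/

import Mathlib

open Matrix

lemma quad_form_eq (A b e d : ℝ) (k : ℕ) (x : Fin (k + 1) → ℝ) :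
    star x ⬝ᵥ ((Matrix.of fun i j : Fin (k + 1) =>
        if i = 0 ∧ j = 0 then A
        else if i = 0 ∨ j = 0 then b
        else (if i = j then e else 0) + d) *ᵥ x)
    = A * x 0 ^ 2 + 2 * b * x 0 * (∑ i : Fin k, x i.succ) + e * (∑ i : Fin k, x i.succ ^ 2)
      + d * (∑ i : Fin k, x i.succ) ^ 2 := by
  simp only [dotProduct, mulVec, Fin.sum_univ_succ, Matrix.of_apply, Fin.succ_ne_zero,
    Fin.succ_inj, and_self, or_self, and_true, true_and, and_false, false_and, or_true, true_or,
    or_false, false_or, if_true, if_false, star_trivial, add_mul, ite_mul, zero_mul,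
    Finset.sum_add_distrib, Finset.sum_ite_eq, Finset.mem_univ, ← Finset.mul_sum, mul_add,
    ← Finset.sum_mul]
  have h : ∑ i : Fin k, x i.succ * (e * x i.succ) = e * ∑ i : Fin k, x i.succ ^ 2 := by
    rw [Finset.mul_sum]; exact Finset.sum_congr rfl fun i _ => by ring
  rw [h]
  ring

/-- Let `α_o ∈ [−1,1]`, `α, b, c ∈ ℝ` with `α² ≤ c ≤ 1`.  For `k ≥ 1` let
`M_k` be the `(k+1)×(k+1)` symmetric matrix with `M_k(0,0) = 1 − α_o²`,
`M_k(0,i) = M_k(i,0) = b` for `1 ≤ i ≤ k`, and `M_k(i,j) = (1−c)·δ_{ij} + (c − α²)`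
for `1 ≤ i,j ≤ k`.  Then `M_k` is positive semidefinite for every `k ≥ 1` iff
`b² ≤ (c − α²)·(1 − α_o²)`. -/
theorem fdt_band_psd_criterion
    (αo α b c : ℝ) (hαo : αo ∈ Set.Icc (-1:ℝ) 1) (hc1 : α ^ 2 ≤ c) (hc2 : c ≤ 1) :
    (∀ k : ℕ, 1 ≤ k →
      (Matrix.of fun i j : Fin (k + 1) =>
        if i = 0 ∧ j = 0 then 1 - αo ^ 2
        else if i = 0 ∨ j = 0 then b
        else (if i = j then 1 - c else 0) + (c - α ^ 2)).PosSemidef)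
    ↔ b ^ 2 ≤ (c - α ^ 2) * (1 - αo ^ 2) := by
  have hA : 0 ≤ 1 - αo ^ 2 := by nlinarith [hαo.1, hαo.2]
  have hd : 0 ≤ c - α ^ 2 := by linarith
  constructor
  · intro h
    have key : ∀ t : ℝ, 0 ≤ (1 - αo ^ 2) * (t * t) + (2 * b) * t + (c - α ^ 2) := by
      intro t
      have hk : ∀ n : ℕ, 0 ≤ ((1 - αo ^ 2) * (t * t) + (2 * b) * t + (c - α ^ 2))
          + (1 - c) * (1 / ((n : ℝ) + 1)) := by
        intro n
        have h1 := (h (n + 1) (by omega)).dotProduct_mulVec_nonneg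
          (Fin.cons t fun _ => 1 / ((n : ℝ) + 1))
        rw [quad_form_eq] at h1
        have hn : (n : ℝ) + 1 ≠ 0 := by positivity
        simp only [Fin.cons_zero, Fin.cons_succ, Finset.sum_const, Finset.card_univ,
          Fintype.card_fin, nsmul_eq_mul, Nat.cast_add, Nat.cast_one] at h1
        have e1 : ((n : ℝ) + 1) * (1 / ((n : ℝ) + 1)) = 1 := by field_simp
        have e2 : ((n : ℝ) + 1) * (1 / ((n : ℝ) + 1)) ^ 2 = 1 / ((n : ℝ) + 1) := by field_simp
        rw [e1, e2] at h1
        linarith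
      have hl := ((tendsto_one_div_add_atTop_nhds_zero_nat (𝕜 := ℝ)).const_mul (1 - c)).const_add
        ((1 - αo ^ 2) * (t * t) + (2 * b) * t + (c - α ^ 2))
      have := ge_of_tendsto' hl hk
      simpa using this
    have := discrim_le_zero key
    unfold discrim at this
    linarith
  · intro h k _
    refine Matrix.PosSemidef.of_dotProduct_mulVec_nonneg ?_ ?_
    · ext i j
      simp only [Matrix.conjTranspose_apply, Matrix.of_apply, star_trivial, and_comm, or_comm,
        eq_comm]
    · intro x
      rw [quad_form_eq]
      set S := ∑ i : Fin k, x i.succ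
      have h2 : 0 ≤ (1 - c) * ∑ i : Fin k, x i.succ ^ 2 :=
        mul_nonneg (by linarith) (Finset.sum_nonneg fun i _ => sq_nonneg _)
      have h3 : 0 ≤ (1 - αo ^ 2) * x 0 ^ 2 + 2 * b * x 0 * S + (c - α ^ 2) * S ^ 2 := by
        generalize 1 - αo ^ 2 = A at *
        generalize c - α ^ 2 = d at *
        generalize x 0 = t
        rcases hA.eq_or_lt with h0 | h0
        · subst h0
          have : b = 0 := by nlinarith [sq_nonneg b]
          subst this
          have := mul_nonneg hd (sq_nonneg S)
          linarith
        · have : 0 ≤ A * (A * t ^ 2 + 2 * b * t * S + d * S ^ 2) := by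
            nlinarith [sq_nonneg (A * t + b * S), mul_nonneg (sub_nonneg.2 h) (sq_nonneg S)]
          exact nonneg_of_mul_nonneg_right this h0
      linarith
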